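/- arXiv:1411.4268 — 2 statements merged into one kernel-verified Lean document; each statement's English description precedes it below -/
import Mathlib

section
/- For n = 1 and α > -1, the Fourier transform of x ↦ K_α(x,y) at ξ ∈ ℝ equals (y|ξ|)^{α+1}/Γ(α+1) · ∫₁^∞ e^{-y|ξ|t}(t²-1)^{α/2} dt for every y > 0 and ξ ≠ 0. -/
open Real MeasureTheory
open Filter Topology Set

lemma tendsto_integral_exp_neg_sq_atTop {ι : Type*} {l : Filter ι} [l.IsCountablyGenerated] {b : ι → ℝ}
    (hb : Tendsto b l atTop) :
    Tendsto (fun i => ∫ s in (0 : ℝ)..b i, rexp (-s ^ 2)) l (𝓝 (√π / 2)) := by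
  have hint : IntegrableOn (fun s : ℝ => rexp (-s ^ 2)) (Ioi 0) := by
    simpa using (integrable_exp_neg_mul_sq one_pos).integrableOn
  have hval : ∫ s in Ioi (0 : ℝ), rexp (-s ^ 2) = √π / 2 := by
    simpa using integral_gaussian_Ioi 1
  exact hval ▸ intervalIntegral_tendsto_integral_Ioi 0 hint hb

lemma tendsto_integral_exp_neg_sq_atBot {ι : Type*} {l : Filter ι} [l.IsCountablyGenerated] {b : ι → ℝ}
    (hb : Tendsto b l atBot) :
    Tendsto (fun i => ∫ s in (0 : ℝ)..b i, rexp (-s ^ 2)) l (𝓝 (-(√π / 2))) := by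
  refine (tendsto_integral_exp_neg_sq_atTop (tendsto_neg_atBot_atTop.comp hb)).neg.congr fun i => ?_
  have h := intervalIntegral.integral_comp_neg (a := 0) (b := b i) fun s : ℝ => rexp (-s ^ 2)
  simp only [neg_sq, neg_zero] at h
  rw [Function.comp_apply, intervalIntegral.integral_symm, ← h, neg_neg]

lemma hasDerivAt_integral_exp_neg_sq (x : ℝ) :
    HasDerivAt (fun u => ∫ s in (0 : ℝ)..u, rexp (-s ^ 2)) (rexp (-x ^ 2)) x :=
  ((by fun_prop : Continuous fun s : ℝ => rexp (-s ^ 2)).integral_hasStrictDerivAt 0 x).hasDerivAt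

lemma integral_Ioi_exp_neg_sq_add_inv_sq {A B : ℝ} (hA : 0 < A) (hB : 0 < B) :
    ∫ x in Ioi (0 : ℝ), rexp (-(B ^ 2 * x ^ 2 + A ^ 2 * (x⁻¹) ^ 2))
      = √π / (2 * B) * rexp (-(2 * A * B)) := by
  set E : ℝ → ℝ := fun u => ∫ s in (0 : ℝ)..u, rexp (-s ^ 2) with hE
  set H : ℝ → ℝ := fun x => rexp (-(2 * A * B)) * E (B * x - A * x⁻¹)
    + rexp (2 * A * B) * E (B * x + A * x⁻¹) with hH
  set m : ℝ := rexp (-(2 * A * B)) * (-(√π / 2)) + rexp (2 * A * B) * (√π / 2) with hm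
  have hAinv : Tendsto (fun x : ℝ => A * x⁻¹) atTop (𝓝 0) := by
    simpa using tendsto_inv_atTop_zero.const_mul A
  have hBtop : Tendsto (fun x : ℝ => B * x) atTop atTop := tendsto_id.const_mul_atTop hB
  have hAinv0 : Tendsto (fun x : ℝ => A * x⁻¹) (𝓝[>] 0) atTop :=
    tendsto_inv_nhdsGT_zero.const_mul_atTop hA
  have hB0 : Tendsto (fun x : ℝ => B * x) (𝓝[>] 0) (𝓝 0) := by
    have : Tendsto (fun x : ℝ => B * x) (𝓝 0) (𝓝 (B * 0)) := tendsto_id.const_mul B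
    simpa using this.mono_left nhdsWithin_le_nhds
  have htop : Tendsto H atTop (𝓝 (rexp (-(2 * A * B)) * (√π / 2) + rexp (2 * A * B) * (√π / 2))) := by
    refine Tendsto.add (Tendsto.const_mul _ ?_) (Tendsto.const_mul _ ?_)
    · refine tendsto_integral_exp_neg_sq_atTop ?_
      simpa [sub_eq_add_neg] using hBtop.atTop_add hAinv.neg
    · exact tendsto_integral_exp_neg_sq_atTop (hBtop.atTop_add hAinv)
  have hzero : Tendsto H (𝓝[>] 0) (𝓝 m) := by
    refine Tendsto.add (Tendsto.const_mul _ ?_) (Tendsto.const_mul _ ?_)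
    · refine tendsto_integral_exp_neg_sq_atBot ?_
      simpa [sub_eq_add_neg] using hB0.add_atBot (tendsto_neg_atTop_atBot.comp hAinv0)
    · exact tendsto_integral_exp_neg_sq_atTop (hB0.add_atTop hAinv0)
  have hderiv : ∀ x ∈ Ioi (0 : ℝ), HasDerivAt H
      (2 * B * rexp (-(B ^ 2 * x ^ 2 + A ^ 2 * (x⁻¹) ^ 2))) x := by
    intro x hx
    have hx0 : x ≠ 0 := ne_of_gt hx
    have hBx : HasDerivAt (fun x : ℝ => B * x) B x := by
      simpa using (hasDerivAt_id x).const_mul B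
    have hAx : HasDerivAt (fun x : ℝ => A * x⁻¹) (A * -(x ^ 2)⁻¹) x :=
      (hasDerivAt_inv hx0).const_mul A
    have h1 := ((hasDerivAt_integral_exp_neg_sq (B * x - A * x⁻¹)).comp x
      (hBx.sub hAx)).const_mul (rexp (-(2 * A * B)))
    have h2 := ((hasDerivAt_integral_exp_neg_sq (B * x + A * x⁻¹)).comp x
      (hBx.add hAx)).const_mul (rexp (2 * A * B))
    have e1 : rexp (-(2 * A * B)) * rexp (-(B * x - A * x⁻¹) ^ 2)
        = rexp (-(B ^ 2 * x ^ 2 + A ^ 2 * (x⁻¹) ^ 2)) := by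
      rw [← Real.exp_add]; congr 1; field_simp; ring
    have e2 : rexp (2 * A * B) * rexp (-(B * x + A * x⁻¹) ^ 2)
        = rexp (-(B ^ 2 * x ^ 2 + A ^ 2 * (x⁻¹) ^ 2)) := by
      rw [← Real.exp_add]; congr 1; field_simp; ring
    refine (h1.add h2).congr_deriv ?_
    rw [← mul_assoc, ← mul_assoc, e1, e2]
    ring
  have hcont : ContinuousWithinAt (Function.update H 0 m) (Ici 0) 0 := by
    rw [continuousWithinAt_update_same]
    simpa using hzero
  have hev : ∀ x ∈ Ioi (0 : ℝ), HasDerivAt (Function.update H 0 m)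
      (2 * B * rexp (-(B ^ 2 * x ^ 2 + A ^ 2 * (x⁻¹) ^ 2))) x := fun x hx =>
    (hderiv x hx).congr_of_eventuallyEq <| by
      filter_upwards [Ioi_mem_nhds hx] with z hz
      exact Function.update_of_ne (ne_of_gt hz) _ _
  have htop' : Tendsto (Function.update H 0 m) atTop _ := htop.congr' <| by
    filter_upwards [Ioi_mem_atTop 0] with z hz
    exact (Function.update_of_ne (ne_of_gt hz) _ _).symm
  have key := integral_Ioi_of_hasDerivAt_of_nonneg hcont hev (fun x _ => by positivity) htop'
  rw [integral_const_mul, Function.update_self] at key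
  have : 2 * B * (√π / (2 * B) * rexp (-(2 * A * B))) = √π * rexp (-(2 * A * B)) := by
    field_simp
  refine mul_left_cancel₀ (by positivity : 2 * B ≠ 0) (key.trans ?_)
  rw [this, hm]
  ring

/-- The subordination formula. -/
lemma integral_Ioi_rpow_neg_three_halves_mul_exp {A B : ℝ} (hA : 0 < A) (hB : 0 < B) :
    ∫ u in Ioi (0 : ℝ), u ^ (-3 / 2 : ℝ) * rexp (-(A ^ 2 * u + B ^ 2 * u⁻¹))
      = √π / B * rexp (-(2 * A * B)) := by
  rw [← integral_comp_rpow_Ioi _ (by norm_num : (-2 : ℝ) ≠ 0)]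
  have : √π / B * rexp (-(2 * A * B)) = 2 * (√π / (2 * B) * rexp (-(2 * A * B))) := by
    field_simp
  rw [this, ← integral_Ioi_exp_neg_sq_add_inv_sq hA hB, ← integral_const_mul]
  refine setIntegral_congr_fun measurableSet_Ioi fun x hx => ?_
  have hx : 0 < x := hx
  have h1 : (x ^ (-2 : ℝ)) ^ (-3 / 2 : ℝ) = x ^ (3 : ℝ) := by
    rw [← rpow_mul hx.le]; norm_num
  have h2 : x ^ (-2 - 1 : ℝ) * x ^ (3 : ℝ) = 1 := by
    rw [← rpow_add hx]; norm_num
  have h3 : x ^ (-2 : ℝ) = (x⁻¹) ^ 2 := by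
    rw [rpow_neg hx.le, inv_pow]; norm_num
  simp only [smul_eq_mul, h1]
  rw [h3, mul_assoc, ← mul_assoc (x ^ (-2 - 1 : ℝ)), h2, one_mul, abs_neg, abs_two]
  congr 3
  field_simp
  ring

lemma integral_Ioi_one_mul_rpow_mul_exp {s c : ℝ} (hs : 0 < s) (hc : 0 < c) :
    ∫ t in Ioi (1 : ℝ), t * (t ^ 2 - 1) ^ (s - 1) * rexp (-(c * t ^ 2))
      = rexp (-c) * ((1 / c) ^ s * Gamma s) / 2 := by
  have himg : (fun t : ℝ => t ^ 2 - 1) '' Ioi 1 = Ioi 0 := by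
    ext w
    simp only [mem_image, mem_Ioi]
    constructor
    · rintro ⟨t, ht, rfl⟩
      nlinarith
    · intro hw
      refine ⟨√(w + 1), ?_, ?_⟩
      · rw [Real.lt_sqrt zero_le_one]; linarith
      · rw [Real.sq_sqrt (by linarith)]; ring
  have hinj : InjOn (fun t : ℝ => t ^ 2 - 1) (Ioi 1) := by
    intro a ha b hb hab
    have ha : 1 < a := ha
    have hb : 1 < b := hb
    have : a ^ 2 = b ^ 2 := by simpa using hab
    exact (pow_left_inj₀ (by linarith) (by linarith) two_ne_zero).1 this
  have hd : ∀ t ∈ Ioi (1 : ℝ), HasDerivWithinAt (fun t : ℝ => t ^ 2 - 1) (2 * t) (Ioi 1) t :=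
    fun t _ => by simpa using ((hasDerivAt_pow 2 t).sub_const 1).hasDerivWithinAt
  have key := integral_image_eq_integral_abs_deriv_smul measurableSet_Ioi hd hinj
    fun w => w ^ (s - 1) * rexp (-(c * w))
  rw [himg, Real.integral_rpow_mul_exp_neg_mul_Ioi hs hc] at key
  rw [key, ← integral_const_mul, ← integral_div]
  refine setIntegral_congr_fun measurableSet_Ioi fun t ht => ?_
  have ht : 1 < t := ht
  have he : rexp (-(c * t ^ 2)) = rexp (-c) * rexp (-(c * (t ^ 2 - 1))) := by
    rw [← Real.exp_add]; congr 1; ring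
  simp only [smul_eq_mul]
  rw [he, abs_of_pos (by linarith)]
  ring

lemma integrableOn_rpow_mul_exp_neg_mul_Ioi {p c : ℝ} (hp : -1 < p) (hc : 0 < c) :
    IntegrableOn (fun u : ℝ => u ^ p * rexp (-(c * u))) (Ioi 0) := by
  simpa using integrableOn_rpow_mul_exp_neg_mul_rpow hp one_pos hc

lemma integrable_rpow_mul_exp_mul_rpow_mul_exp {s y r : ℝ} (hs : 1 / 2 < s) (hy : 0 < y)
    (hr : 0 < r) :
    Integrable (Function.uncurry fun t u : ℝ =>
        t * (t ^ 2 - 1) ^ (s - 1) * rexp (-((r / 2) ^ 2 * u⁻¹ * t ^ 2))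
          * (u ^ (-3 / 2 : ℝ) * rexp (-(y ^ 2 * u))))
      ((volume.restrict (Ioi 1)).prod (volume.restrict (Ioi 0))) := by
  have hs0 : 0 < s := by linarith
  have hmeas : Measurable (Function.uncurry fun t u : ℝ =>
      t * (t ^ 2 - 1) ^ (s - 1) * rexp (-((r / 2) ^ 2 * u⁻¹ * t ^ 2))
        * (u ^ (-3 / 2 : ℝ) * rexp (-(y ^ 2 * u)))) := by
    unfold Function.uncurry
    fun_prop
  rw [integrable_prod_iff' hmeas.aestronglyMeasurable]
  constructor
  · filter_upwards [ae_restrict_mem measurableSet_Ioi] with u hu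
    have hu : 0 < u := hu
    suffices h : Integrable (fun t : ℝ => t * (t ^ 2 - 1) ^ (s - 1)
        * rexp (-((r / 2) ^ 2 * u⁻¹ * t ^ 2))) (volume.restrict (Ioi 1)) from
      h.mul_const (u ^ (-3 / 2 : ℝ) * rexp (-(y ^ 2 * u)))
    refine Integrable.of_integral_ne_zero ?_
    rw [integral_Ioi_one_mul_rpow_mul_exp hs0 (by positivity)]
    have := Gamma_pos_of_pos hs0
    positivity
  · have hdom := (integrableOn_rpow_mul_exp_neg_mul_Ioi (p := s - 3 / 2) (c := y ^ 2)
      (by linarith) (by positivity)).const_mul ((1 / (r / 2) ^ 2) ^ s * Gamma s / 2)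
    refine hdom.mono' hmeas.norm.stronglyMeasurable.integral_prod_left'.aestronglyMeasurable ?_
    filter_upwards [ae_restrict_mem measurableSet_Ioi] with u hu
    have hu : 0 < u := hu
    have hnorm : ∫ t in Ioi (1 : ℝ), ‖Function.uncurry (fun t u : ℝ =>
        t * (t ^ 2 - 1) ^ (s - 1) * rexp (-((r / 2) ^ 2 * u⁻¹ * t ^ 2))
          * (u ^ (-3 / 2 : ℝ) * rexp (-(y ^ 2 * u)))) (t, u)‖
        = (∫ t in Ioi (1 : ℝ), t * (t ^ 2 - 1) ^ (s - 1) * rexp (-((r / 2) ^ 2 * u⁻¹ * t ^ 2)))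
          * (u ^ (-3 / 2 : ℝ) * rexp (-(y ^ 2 * u))) := by
      rw [← integral_mul_const]
      refine setIntegral_congr_fun measurableSet_Ioi fun t ht => ?_
      have ht : 1 < t := ht
      have : 0 ≤ (t ^ 2 - 1) ^ (s - 1) := rpow_nonneg (by nlinarith) _
      exact norm_of_nonneg (by simp only [Function.uncurry]; positivity)
    rw [hnorm, integral_Ioi_one_mul_rpow_mul_exp hs0 (by positivity)]
    have hG := Gamma_pos_of_pos hs0
    rw [norm_of_nonneg (by positivity)]
    have h1 : (1 / ((r / 2) ^ 2 * u⁻¹)) ^ s = (1 / (r / 2) ^ 2) ^ s * u ^ s := by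
      rw [← mul_rpow (by positivity) hu.le]; congr 1; field_simp
    have h2 : u ^ s * u ^ (-3 / 2 : ℝ) = u ^ (s - 3 / 2) := by
      rw [← rpow_add hu]; ring_nf
    have h3 : rexp (-((r / 2) ^ 2 * u⁻¹)) ≤ 1 := exp_le_one_iff.2 (by
      have : 0 < (r / 2) ^ 2 * u⁻¹ := by positivity
      linarith)
    calc _ = rexp (-((r / 2) ^ 2 * u⁻¹)) *
          ((1 / (r / 2) ^ 2) ^ s * Gamma s / 2 * (u ^ (s - 3 / 2) * rexp (-(y ^ 2 * u)))) := by
          rw [h1, ← h2]; ring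
      _ ≤ _ := mul_le_of_le_one_left (by positivity) h3

lemma integral_Ioi_one_exp_mul_rpow {s y r : ℝ} (hs : 1 / 2 < s) (hy : 0 < y) (hr : 0 < r) :
    ∫ t in Ioi (1 : ℝ), rexp (-(y * r) * t) * (t ^ 2 - 1) ^ (s - 1)
      = r / (4 * √π) * ((1 / (r / 2) ^ 2) ^ s * Gamma s)
        * ∫ u in Ioi (0 : ℝ), u ^ (s - 3 / 2) * rexp (-(y ^ 2 * u + (r / 2) ^ 2 * u⁻¹)) := by
  have hs0 : 0 < s := by linarith
  calc ∫ t in Ioi (1 : ℝ), rexp (-(y * r) * t) * (t ^ 2 - 1) ^ (s - 1)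
      = r / (2 * √π) * ∫ t in Ioi (1 : ℝ), ∫ u in Ioi (0 : ℝ),
          t * (t ^ 2 - 1) ^ (s - 1) * rexp (-((r / 2) ^ 2 * u⁻¹ * t ^ 2))
            * (u ^ (-3 / 2 : ℝ) * rexp (-(y ^ 2 * u))) := by
        rw [← integral_const_mul]
        refine setIntegral_congr_fun measurableSet_Ioi fun t ht => ?_
        have ht : 1 < t := ht
        have ht0 : 0 < t := by linarith
        have hlevy := integral_Ioi_rpow_neg_three_halves_mul_exp hy
          (by positivity : 0 < r / 2 * t)
        have hin : ∫ u in Ioi (0 : ℝ), t * (t ^ 2 - 1) ^ (s - 1)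
            * rexp (-((r / 2) ^ 2 * u⁻¹ * t ^ 2)) * (u ^ (-3 / 2 : ℝ) * rexp (-(y ^ 2 * u)))
            = t * (t ^ 2 - 1) ^ (s - 1) * ∫ u in Ioi (0 : ℝ),
              u ^ (-3 / 2 : ℝ) * rexp (-(y ^ 2 * u + (r / 2 * t) ^ 2 * u⁻¹)) := by
          rw [← integral_const_mul]
          refine integral_congr_ae (ae_of_all _ fun u => ?_)
          have : rexp (-(y ^ 2 * u + (r / 2 * t) ^ 2 * u⁻¹))
              = rexp (-((r / 2) ^ 2 * u⁻¹ * t ^ 2)) * rexp (-(y ^ 2 * u)) := by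
            rw [← Real.exp_add]; congr 1; ring
          simp only [this]
          ring
        simp only [hin, hlevy]
        rw [show -(2 * y * (r / 2 * t)) = -(y * r) * t by ring]
        field_simp
    _ = r / (2 * √π) * ∫ u in Ioi (0 : ℝ), ∫ t in Ioi (1 : ℝ),
          t * (t ^ 2 - 1) ^ (s - 1) * rexp (-((r / 2) ^ 2 * u⁻¹ * t ^ 2))
            * (u ^ (-3 / 2 : ℝ) * rexp (-(y ^ 2 * u))) := by
        rw [integral_integral_swap (integrable_rpow_mul_exp_mul_rpow_mul_exp hs hy hr)]
    _ = _ := by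
        rw [← integral_const_mul, ← integral_const_mul]
        refine setIntegral_congr_fun measurableSet_Ioi fun u hu => ?_
        have hu : 0 < u := hu
        have h1 : (1 / ((r / 2) ^ 2 * u⁻¹)) ^ s = (1 / (r / 2) ^ 2) ^ s * u ^ s := by
          rw [← mul_rpow (by positivity) hu.le]; congr 1; field_simp
        have h2 : u ^ s * u ^ (-3 / 2 : ℝ) = u ^ (s - 3 / 2) := by
          rw [← rpow_add hu]; ring_nf
        have h3 : rexp (-(y ^ 2 * u + (r / 2) ^ 2 * u⁻¹))
            = rexp (-((r / 2) ^ 2 * u⁻¹)) * rexp (-(y ^ 2 * u)) := by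
          rw [← Real.exp_add]; congr 1; ring
        rw [integral_mul_const, integral_Ioi_one_mul_rpow_mul_exp hs0 (by positivity), h1, ← h2, h3]
        field_simp
        ring

lemma integral_exp_neg_mul_sq_add_sq {y u : ℝ} (hu : 0 < u) (s : ℝ) :
    ∫ x : ℝ, u ^ (s - 1) * rexp (-((x ^ 2 + y ^ 2) * u))
      = √π * (u ^ (s - 3 / 2) * rexp (-(y ^ 2 * u))) := by
  have h2 : u ^ (s - 1) = u ^ (s - 3 / 2) * √u := by
    rw [sqrt_eq_rpow, ← rpow_add hu]; ring_nf
  have h (x : ℝ) : u ^ (s - 1) * rexp (-((x ^ 2 + y ^ 2) * u))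
      = u ^ (s - 1) * rexp (-(y ^ 2 * u)) * rexp (-u * x ^ 2) := by
    rw [mul_assoc, ← Real.exp_add]; congr 2; ring
  simp_rw [h]
  rw [integral_const_mul, integral_gaussian, sqrt_div pi_pos.le, h2]
  have : √u ≠ 0 := (sqrt_pos.2 hu).ne'
  field_simp

lemma integral_cexp_mul_exp_neg_mul_sq_add_sq {y u : ℝ} (hu : 0 < u) (s ξ : ℝ) :
    ∫ x : ℝ, Complex.exp (-Complex.I * x * ξ)
        * ((u ^ (s - 1) * rexp (-((x ^ 2 + y ^ 2) * u)) : ℝ) : ℂ)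
      = ((√π * (u ^ (s - 3 / 2) * rexp (-(y ^ 2 * u + (|ξ| / 2) ^ 2 * u⁻¹))) : ℝ) : ℂ) := by
  have h2 : u ^ (s - 1) = u ^ (s - 3 / 2) * √u := by
    rw [sqrt_eq_rpow, ← rpow_add hu]; ring_nf
  have h (x : ℝ) : Complex.exp (-Complex.I * x * ξ)
        * ((u ^ (s - 1) * rexp (-((x ^ 2 + y ^ 2) * u)) : ℝ) : ℂ)
      = ((u ^ (s - 1) * rexp (-(y ^ 2 * u)) : ℝ) : ℂ)
        * (Complex.exp (Complex.I * (-ξ : ℂ) * x) * Complex.exp (-(u : ℂ) * x ^ 2)) := by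
    rw [show -((x ^ 2 + y ^ 2) * u) = -(y ^ 2 * u) + -u * x ^ 2 by ring, Real.exp_add,
      show -Complex.I * x * ξ = Complex.I * (-ξ : ℂ) * x by ring]
    push_cast
    ring
  have hpow : ((π : ℂ) / u) ^ (1 / 2 : ℂ) = ((√π / √u : ℝ) : ℂ) := by
    rw [← sqrt_div pi_pos.le, sqrt_eq_rpow, Complex.ofReal_cpow (by positivity)]
    push_cast
    rfl
  have hexp : Complex.exp (-(-ξ : ℂ) ^ 2 / (4 * u))
      = ((rexp (-((|ξ| / 2) ^ 2 * u⁻¹)) : ℝ) : ℂ) := by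
    rw [div_pow, sq_abs, Complex.ofReal_exp]
    congr 1
    push_cast
    field_simp
    ring
  simp_rw [h]
  rw [integral_const_mul, fourierIntegral_gaussian (by simpa using hu), hpow, hexp,
    ← Complex.ofReal_mul, ← Complex.ofReal_mul, h2, neg_add, Real.exp_add]
  congr 1
  have : √u ≠ 0 := (sqrt_pos.2 hu).ne'
  field_simp

lemma integral_cexp_div_rpow {s y : ℝ} (hs : 1 / 2 < s) (hy : 0 < y) (ξ : ℝ) :
    ∫ x : ℝ, Complex.exp (-Complex.I * x * ξ) * ((((1 / (x ^ 2 + y ^ 2)) ^ s * Gamma s : ℝ)) : ℂ)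
      = ((√π * ∫ u in Ioi (0 : ℝ),
          u ^ (s - 3 / 2) * rexp (-(y ^ 2 * u + (|ξ| / 2) ^ 2 * u⁻¹)) : ℝ) : ℂ) := by
  have hs0 : 0 < s := by linarith
  have hnorm (x u : ℝ) (hu : 0 < u) : ‖Complex.exp (-Complex.I * x * ξ)
      * ((u ^ (s - 1) * rexp (-((x ^ 2 + y ^ 2) * u)) : ℝ) : ℂ)‖
      = u ^ (s - 1) * rexp (-((x ^ 2 + y ^ 2) * u)) := by
    rw [norm_mul, Complex.norm_real, norm_of_nonneg (by positivity),
      show -Complex.I * x * ξ = ((-(x * ξ) : ℝ) : ℂ) * Complex.I by push_cast; ring,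
      Complex.norm_exp_ofReal_mul_I, one_mul]
  have hmeas : Measurable (Function.uncurry fun x u : ℝ => Complex.exp (-Complex.I * x * ξ)
      * ((u ^ (s - 1) * rexp (-((x ^ 2 + y ^ 2) * u)) : ℝ) : ℂ)) := by
    unfold Function.uncurry
    fun_prop
  have hint : Integrable (Function.uncurry fun x u : ℝ => Complex.exp (-Complex.I * x * ξ)
      * ((u ^ (s - 1) * rexp (-((x ^ 2 + y ^ 2) * u)) : ℝ) : ℂ))
      (volume.prod (volume.restrict (Ioi 0))) := by
    rw [integrable_prod_iff' hmeas.aestronglyMeasurable]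
    constructor
    · filter_upwards [ae_restrict_mem measurableSet_Ioi] with u hu
      have hu : 0 < u := hu
      refine Integrable.mono' (g := fun x => u ^ (s - 1) * rexp (-((x ^ 2 + y ^ 2) * u)))
        (Integrable.of_integral_ne_zero ?_)
        (hmeas.comp measurable_prodMk_right).aestronglyMeasurable
        (ae_of_all _ fun x => (hnorm x u hu).le)
      rw [integral_exp_neg_mul_sq_add_sq hu]
      positivity
    · refine ((integrableOn_rpow_mul_exp_neg_mul_Ioi (p := s - 3 / 2) (c := y ^ 2)
        (by linarith) (by positivity)).const_mul √π).congr ?_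
      filter_upwards [ae_restrict_mem measurableSet_Ioi] with u hu
      rw [← integral_exp_neg_mul_sq_add_sq hu]
      exact integral_congr_ae (ae_of_all _ fun x => (hnorm x u hu).symm)
  calc _ = ∫ x : ℝ, ∫ u in Ioi (0 : ℝ), Complex.exp (-Complex.I * x * ξ)
        * ((u ^ (s - 1) * rexp (-((x ^ 2 + y ^ 2) * u)) : ℝ) : ℂ) := by
        refine integral_congr_ae (ae_of_all _ fun x => ?_)
        simp only
        rw [integral_const_mul, integral_complex_ofReal,
          Real.integral_rpow_mul_exp_neg_mul_Ioi hs0 (by positivity)]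
    _ = ∫ u in Ioi (0 : ℝ), ∫ x : ℝ, Complex.exp (-Complex.I * x * ξ)
        * ((u ^ (s - 1) * rexp (-((x ^ 2 + y ^ 2) * u)) : ℝ) : ℂ) := integral_integral_swap hint
    _ = _ := by
        rw [← integral_const_mul, ← integral_complex_ofReal]
        exact setIntegral_congr_fun measurableSet_Ioi fun u hu =>
          integral_cexp_mul_exp_neg_mul_sq_add_sq hu s ξ

theorem stmt8 (α : ℝ) (hα : -1 < α)
    (K : ℝ → ℝ → ℝ)
    (hK : K = fun x y =>
      Real.Gamma ((α + 2) / 2) / (Real.Gamma ((α + 1) / 2) * Real.sqrt Real.pi)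
        * y ^ (α + 1) / (x ^ 2 + y ^ 2) ^ ((α + 2) / 2))
    (y : ℝ) (hy : 0 < y) (ξ : ℝ) (hξ : ξ ≠ 0) :
    ∫ x : ℝ, Complex.exp (-Complex.I * x * ξ) * (K x y : ℂ)
      = (((y * |ξ|) ^ (α + 1) / Real.Gamma (α + 1)
          * ∫ t in Set.Ioi (1 : ℝ), Real.exp (-(y * |ξ|) * t) * (t ^ 2 - 1) ^ (α / 2) : ℝ) : ℂ) := by
  have hr : 0 < |ξ| := abs_pos.2 hξ
  have hν : 0 < (α + 1) / 2 := by linarith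
  have hs : 1 / 2 < (α + 2) / 2 := by linarith
  have hG1 := (Gamma_pos_of_pos hν).ne'
  have hG2 := (Gamma_pos_of_pos (by linarith : 0 < α + 1)).ne'
  have hdup := Gamma_mul_Gamma_add_half ((α + 1) / 2)
  rw [show (α + 1) / 2 + 1 / 2 = (α + 2) / 2 by ring, show 2 * ((α + 1) / 2) = α + 1 by ring,
    show 1 - (α + 1) = -α by ring] at hdup
  have hrhs := integral_Ioi_one_exp_mul_rpow hs hy hr
  rw [show (α + 2) / 2 - 1 = α / 2 by ring] at hrhs
  have hlhs (x : ℝ) : Complex.exp (-Complex.I * x * ξ) * (K x y : ℂ)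
      = ((y ^ (α + 1) / (Gamma ((α + 1) / 2) * √π) : ℝ) : ℂ) * (Complex.exp (-Complex.I * x * ξ)
        * (((1 / (x ^ 2 + y ^ 2)) ^ ((α + 2) / 2) * Gamma ((α + 2) / 2) : ℝ) : ℂ)) := by
    rw [hK, mul_left_comm, ← Complex.ofReal_mul, one_div, inv_rpow (by positivity)]
    congr 2
    ring
  simp_rw [hlhs]
  rw [integral_const_mul, integral_cexp_div_rpow hs hy, ← Complex.ofReal_mul, hrhs]
  congr 1
  have hpow : (1 / (|ξ| / 2) ^ 2) ^ ((α + 2) / 2) = 4 * 2 ^ α / (|ξ| ^ (α + 1) * |ξ|) := by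
    rw [show 1 / (|ξ| / 2) ^ 2 = (2 / |ξ|) ^ (2 : ℝ) by norm_num; field_simp,
      ← rpow_mul (by positivity), show 2 * ((α + 2) / 2) = α + 1 + 1 by ring,
      div_rpow zero_le_two hr.le, rpow_add_one hr.ne', rpow_add_one two_ne_zero,
      rpow_add_one two_ne_zero]
    ring
  rw [rpow_neg zero_le_two] at hdup
  have hdup' : Gamma ((α + 2) / 2)
      = Gamma (α + 1) * (2 ^ α)⁻¹ * √π / Gamma ((α + 1) / 2) := by
    rw [← hdup]; field_simp
  have hrp : |ξ| ^ (α + 1) ≠ 0 := (rpow_pos_of_pos hr _).ne'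
  have h2 : (2 : ℝ) ^ α ≠ 0 := (rpow_pos_of_pos two_pos _).ne'
  rw [hpow, hdup', mul_rpow hy.le hr.le]
  field_simp
end

section
/- Let α > -1. If f ∈ L¹(ℝⁿ, (1+|x|²)^{-(α+n+1)/2} dx), then the convolution K_α(·,y) * f converges to f in L¹(ℝⁿ, (1+|x|²)^{-(α+n+1)/2} dx) as y → 0⁺. -/
open Real MeasureTheory Filter Topology

section GeneralizedPoissonKernel

/-- If `a ≤ M * b` then `b⁻ˢ ≤ Mˢ a⁻ˢ`. -/
theorem rpow_neg_le_mul_rpow_neg {a b M s : ℝ} (ha : 0 < a) (hb : 0 < b) (hM : 0 < M)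
    (hs : 0 ≤ s) (h : a ≤ M * b) : b ^ (-s) ≤ M ^ s * a ^ (-s) := by
  have := rpow_le_rpow_of_nonpos ha h (neg_nonpos.2 hs)
  rw [mul_rpow hM.le hb.le, rpow_neg hM.le] at this
  calc b ^ (-s) = M ^ s * ((M ^ s)⁻¹ * b ^ (-s)) := by
        rw [mul_inv_cancel_left₀ (rpow_pos_of_pos hM s).ne']
    _ ≤ _ := by gcongr

open Module

variable {V : Type*} [NormedAddCommGroup V] [InnerProductSpace ℝ V]

/-- The weight `(1 + ‖x‖²)^(-(α + n + 1) / 2)` on an `n`-dimensional Euclidean space. -/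
noncomputable def poissonWeight (α : ℝ) (x : V) : ℝ :=
  (1 + ‖x‖ ^ 2) ^ (-((α + finrank ℝ V + 1) / 2))

/-- The generalized Poisson kernel `K_α(x, y)` on a Euclidean space. -/
noncomputable def poissonKernelGen (α y : ℝ) (x : V) : ℝ :=
  Gamma ((α + finrank ℝ V + 1) / 2) / (Gamma ((α + 1) / 2) * π ^ ((finrank ℝ V : ℝ) / 2))
    * y ^ (α + 1) / (‖x‖ ^ 2 + y ^ 2) ^ ((α + finrank ℝ V + 1) / 2)

variable {α y : ℝ}

theorem poissonWeight_pos (x : V) : 0 < poissonWeight α x := by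
  unfold poissonWeight
  positivity

theorem continuous_poissonWeight : Continuous (poissonWeight α : V → ℝ) :=
  Continuous.rpow_const (by fun_prop) fun x => Or.inl (by positivity)

theorem poissonWeight_le_one (hα : -1 < α) (x : V) : poissonWeight α x ≤ 1 :=
  rpow_le_one_of_one_le_of_nonpos (by nlinarith [sq_nonneg ‖x‖])
    (by have : (0 : ℝ) ≤ finrank ℝ V := by positivity
        linarith)

theorem poissonKernelGen_nonneg (hα : -1 < α) (hy : 0 < y) (x : V) :
    0 ≤ poissonKernelGen α y x := by
  have : (0 : ℝ) ≤ finrank ℝ V := by positivity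
  have h1 := Gamma_pos_of_pos (show 0 < (α + finrank ℝ V + 1) / 2 by linarith)
  have h2 := Gamma_pos_of_pos (show 0 < (α + 1) / 2 by linarith)
  unfold poissonKernelGen
  positivity

theorem poissonKernelGen_one (x : V) : poissonKernelGen α 1 x =
    Gamma ((α + finrank ℝ V + 1) / 2) / (Gamma ((α + 1) / 2) * π ^ ((finrank ℝ V : ℝ) / 2))
      * poissonWeight α x := by
  unfold poissonKernelGen poissonWeight
  rw [one_rpow, one_pow, rpow_neg (by positivity), add_comm (‖x‖ ^ 2)]
  ring

theorem poissonKernelGen_eq_smul (hy : 0 < y) (x : V) :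
    poissonKernelGen α y x = y⁻¹ ^ finrank ℝ V * poissonKernelGen α 1 (y⁻¹ • x) := by
  unfold poissonKernelGen
  have h : ‖x‖ ^ 2 + y ^ 2 = y ^ 2 * (‖y⁻¹ • x‖ ^ 2 + 1 ^ 2) := by
    rw [norm_smul, norm_of_nonneg (by positivity)]
    field_simp
  rw [h, mul_rpow (by positivity) (by positivity), ← rpow_natCast_mul hy.le, one_rpow,
    ← rpow_natCast y⁻¹, inv_rpow hy.le,
    show ((2 : ℕ) : ℝ) * ((α + finrank ℝ V + 1) / 2) = (α + 1) + finrank ℝ V by push_cast; ring,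
    rpow_add hy (α + 1)]
  field_simp

theorem poissonKernelGen_mul_poissonWeight_le (hα : -1 < α) (hy : 0 < y) (x z : V) :
    poissonKernelGen α y (x - z) * poissonWeight α x ≤
      4 ^ ((α + finrank ℝ V + 1) / 2) * poissonWeight α z *
        (poissonKernelGen α y (x - z) + y ^ (α + 1) * poissonKernelGen α 1 x) := by
  have hd : (0 : ℝ) ≤ finrank ℝ V := by positivity
  have hs : 0 ≤ (α + finrank ℝ V + 1) / 2 := by linarith
  have h1 := Gamma_pos_of_pos (show 0 < (α + finrank ℝ V + 1) / 2 by linarith)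
  have h2 := Gamma_pos_of_pos (show 0 < (α + 1) / 2 by linarith)
  have hK := poissonKernelGen_nonneg hα hy (x - z)
  have hK1 := poissonKernelGen_nonneg hα one_pos x
  have hw := poissonWeight_pos (α := α) x
  have hw' := poissonWeight_pos (α := α) z
  have hz : ‖z‖ ^ 2 ≤ 2 * ‖x‖ ^ 2 + 2 * ‖x - z‖ ^ 2 := by
    have := norm_sub_le x (x - z)
    rw [sub_sub_cancel] at this
    nlinarith [norm_nonneg z, sq_nonneg (‖x‖ - ‖x - z‖)]
  by_cases h : 1 + ‖z‖ ^ 2 ≤ 4 * (1 + ‖x‖ ^ 2)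
  · have hle : poissonWeight α x ≤ 4 ^ ((α + finrank ℝ V + 1) / 2) * poissonWeight α z :=
      rpow_neg_le_mul_rpow_neg (by positivity) (by positivity) (by norm_num) hs h
    calc _ ≤ poissonKernelGen α y (x - z) *
          (4 ^ ((α + finrank ℝ V + 1) / 2) * poissonWeight α z) := by gcongr
      _ = 4 ^ ((α + finrank ℝ V + 1) / 2) * poissonWeight α z * poissonKernelGen α y (x - z) := by
        ring
      _ ≤ _ := by
        gcongr
        exact le_add_of_nonneg_right (by positivity)
  · have hle : (‖x - z‖ ^ 2 + y ^ 2) ^ (-((α + finrank ℝ V + 1) / 2)) ≤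
        4 ^ ((α + finrank ℝ V + 1) / 2) * poissonWeight α z :=
      rpow_neg_le_mul_rpow_neg (by positivity) (by positivity) (by norm_num) hs
        (by nlinarith [sq_nonneg y])
    calc _ = y ^ (α + 1) * poissonKernelGen α 1 x *
          (‖x - z‖ ^ 2 + y ^ 2) ^ (-((α + finrank ℝ V + 1) / 2)) := by
          rw [poissonKernelGen_one, poissonKernelGen, rpow_neg (by positivity)]
          ring
      _ ≤ y ^ (α + 1) * poissonKernelGen α 1 x *
          (4 ^ ((α + finrank ℝ V + 1) / 2) * poissonWeight α z) := by gcongr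
      _ = 4 ^ ((α + finrank ℝ V + 1) / 2) * poissonWeight α z *
          (y ^ (α + 1) * poissonKernelGen α 1 x) := by ring
      _ ≤ _ := by
        gcongr
        exact le_add_of_nonneg_left hK

theorem tendsto_norm_pow_mul_poissonKernelGen_one (hα : -1 < α) :
    Tendsto (fun x : V => ‖x‖ ^ finrank ℝ V * poissonKernelGen α 1 x) (Bornology.cobounded V)
      (𝓝 0) := by
  have h1 : Tendsto (fun x : V => 1 + ‖x‖ ^ 2) (Bornology.cobounded V) atTop :=
    tendsto_atTop_add_const_left _ _
      ((tendsto_pow_atTop two_ne_zero).comp tendsto_norm_cobounded_atTop)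
  have h2 := ((tendsto_rpow_neg_atTop (show 0 < (α + 1) / 2 by linarith)).comp h1).const_mul
    (Gamma ((α + finrank ℝ V + 1) / 2) / (Gamma ((α + 1) / 2) * π ^ ((finrank ℝ V : ℝ) / 2)))
  rw [mul_zero] at h2
  refine squeeze_zero (fun x => mul_nonneg (by positivity) (poissonKernelGen_nonneg hα one_pos x))
    (fun x => ?_) h2
  have hd : (0 : ℝ) ≤ finrank ℝ V := by positivity
  have g1 := Gamma_pos_of_pos (show 0 < (α + finrank ℝ V + 1) / 2 by linarith)
  have g2 := Gamma_pos_of_pos (show 0 < (α + 1) / 2 by linarith)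
  have hx : ‖x‖ ^ finrank ℝ V ≤ (1 + ‖x‖ ^ 2) ^ ((finrank ℝ V : ℝ) / 2) := by
    calc ‖x‖ ^ finrank ℝ V = (‖x‖ ^ 2) ^ ((finrank ℝ V : ℝ) / 2) := by
          rw [← rpow_natCast_mul (norm_nonneg x), ← rpow_natCast]
          congr 1
          push_cast
          ring
      _ ≤ _ := by
          gcongr
          linarith
  rw [poissonKernelGen_one, mul_left_comm]
  simp only [Function.comp_apply]
  gcongr
  calc _ ≤ (1 + ‖x‖ ^ 2) ^ ((finrank ℝ V : ℝ) / 2) * poissonWeight α x := by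
        gcongr
        exact (poissonWeight_pos x).le
    _ = _ := by
        rw [poissonWeight, ← rpow_add (by positivity)]
        congr 1
        ring

variable [MeasurableSpace V] [BorelSpace V]

theorem measurable_poissonWeight : Measurable (poissonWeight α : V → ℝ) := by
  unfold poissonWeight
  fun_prop

theorem measurable_poissonKernelGen : Measurable (poissonKernelGen α y : V → ℝ) := by
  unfold poissonKernelGen
  fun_prop

variable [FiniteDimensional ℝ V]

/-- The integral of `(1 + ‖x‖²)⁻ˢ` over a Euclidean space, for `s` above half the dimension. -/
theorem integral_one_add_norm_sq_rpow_neg {s : ℝ} (hs : (finrank ℝ V : ℝ) / 2 < s) :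
    ∫ x : V, (1 + ‖x‖ ^ 2) ^ (-s) =
      Gamma (s - finrank ℝ V / 2) * π ^ ((finrank ℝ V : ℝ) / 2) / Gamma s := by
  have hd : (0 : ℝ) ≤ finrank ℝ V / 2 := by positivity
  have hs0 : 0 < s := hd.trans_lt hs
  have hΓ : 0 < Gamma s := Gamma_pos_of_pos hs0
  have hint : Integrable (fun x : V => (1 + ‖x‖ ^ 2) ^ (-s)) := by
    convert integrable_rpow_neg_one_add_norm_sq (E := V) (μ := volume) (r := 2 * s) (by linarith)
      using 3
    ring
  let F : V → ℝ → ℝ := fun x t => t ^ (s - 1) * exp (-((1 + ‖x‖ ^ 2) * t))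
  have hFx : ∀ x, ∫ t in Set.Ioi 0, F x t = (1 + ‖x‖ ^ 2) ^ (-s) * Gamma s := fun x => by
    rw [integral_rpow_mul_exp_neg_mul_Ioi hs0 (by positivity), one_div,
      inv_rpow (by positivity), rpow_neg (by positivity)]
  have hFt : ∀ t ∈ Set.Ioi (0 : ℝ), ∫ x, F x t =
      π ^ ((finrank ℝ V : ℝ) / 2) * (t ^ (s - finrank ℝ V / 2 - 1) * exp (-(1 * t))) := by
    intro t ht
    have ht : 0 < t := ht
    have : ∀ x, F x t = t ^ (s - 1) * exp (-t) * exp (-t * ‖x‖ ^ 2) := fun x => by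
      simp only [F]
      rw [mul_assoc, ← exp_add]
      ring_nf
    simp_rw [this]
    rw [integral_const_mul, GaussianFourier.integral_rexp_neg_mul_sq_norm ht,
      div_rpow pi_pos.le ht.le, show s - finrank ℝ V / 2 - 1 = (s - 1) - finrank ℝ V / 2 by ring,
      rpow_sub ht (s - 1), one_mul]
    ring
  have hprod : Integrable (Function.uncurry F) (volume.prod (volume.restrict (Set.Ioi 0))) := by
    rw [integrable_prod_iff (by
      apply Measurable.aestronglyMeasurable
      simp only [F, Function.uncurry_def]
      fun_prop)]
    have hnorm : ∀ x, ∫ t in Set.Ioi 0, ‖F x t‖ = (1 + ‖x‖ ^ 2) ^ (-s) * Gamma s := fun x => by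
      rw [← hFx]
      refine setIntegral_congr_fun measurableSet_Ioi fun t ht => ?_
      have ht : 0 < t := ht
      exact norm_of_nonneg (by positivity)
    refine ⟨Eventually.of_forall fun x => .of_integral_ne_zero ?_, ?_⟩
    · simp only [Function.uncurry_apply_pair, hFx]
      positivity
    · simp only [Function.uncurry_apply_pair, hnorm]
      exact hint.mul_const _
  have hswap := integral_integral_swap hprod
  simp_rw [hFx] at hswap
  rw [setIntegral_congr_fun measurableSet_Ioi hFt, integral_mul_const, integral_const_mul,
    integral_rpow_mul_exp_neg_mul_Ioi (by linarith) one_pos] at hswap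
  rw [eq_div_iff hΓ.ne', hswap]
  simp [mul_comm]

theorem integrable_poissonWeight (hα : -1 < α) : Integrable (poissonWeight α : V → ℝ) := by
  unfold poissonWeight
  convert integrable_rpow_neg_one_add_norm_sq (E := V) (μ := volume)
    (r := α + finrank ℝ V + 1) (by linarith) using 3
  ring

theorem integral_poissonKernelGen_one (hα : -1 < α) : ∫ x : V, poissonKernelGen α 1 x = 1 := by
  have : (0 : ℝ) ≤ finrank ℝ V := by positivity
  have h1 := Gamma_pos_of_pos (show 0 < (α + finrank ℝ V + 1) / 2 by linarith)
  have h2 := Gamma_pos_of_pos (show 0 < (α + 1) / 2 by linarith)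
  simp_rw [poissonKernelGen_one, integral_const_mul]
  unfold poissonWeight
  rw [integral_one_add_norm_sq_rpow_neg (by linarith),
    show (α + finrank ℝ V + 1) / 2 - (finrank ℝ V : ℝ) / 2 = (α + 1) / 2 by ring]
  field_simp

theorem integrable_poissonKernelGen (hα : -1 < α) (hy : 0 < y) :
    Integrable (poissonKernelGen α y : V → ℝ) := by
  have h1 : Integrable (poissonKernelGen α 1 : V → ℝ) :=
    .of_integral_ne_zero (by rw [integral_poissonKernelGen_one hα]; exact one_ne_zero)
  rw [funext (poissonKernelGen_eq_smul hy)]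
  exact ((integrable_comp_smul_iff volume _ (inv_pos.2 hy).ne').2 h1).const_mul _

theorem integral_poissonKernelGen (hα : -1 < α) (hy : 0 < y) :
    ∫ x : V, poissonKernelGen α y x = 1 := by
  simp_rw [poissonKernelGen_eq_smul hy, integral_const_mul]
  rw [Measure.integral_comp_inv_smul_of_nonneg _ _ hy.le, integral_poissonKernelGen_one hα,
    smul_eq_mul, mul_one, ← mul_pow, inv_mul_cancel₀ hy.ne', one_pow]

theorem integrable_poissonKernelGen_mul_poissonWeight (hα : -1 < α) (hy : 0 < y) (z : V) :
    Integrable fun x => poissonKernelGen α y (x - z) * poissonWeight α x :=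
  ((integrable_poissonKernelGen hα hy).comp_sub_right z).mul_bdd (c := 1)
    measurable_poissonWeight.aestronglyMeasurable
    (Eventually.of_forall fun x => by
      rw [norm_of_nonneg (poissonWeight_pos x).le]
      exact poissonWeight_le_one hα x)

theorem integral_poissonKernelGen_mul_poissonWeight_le (hα : -1 < α) (hy : 0 < y) (hy1 : y ≤ 1)
    (z : V) : ∫ x, poissonKernelGen α y (x - z) * poissonWeight α x ≤
      2 * 4 ^ ((α + finrank ℝ V + 1) / 2) * poissonWeight α z := by
  have hw := poissonWeight_pos (α := α) z
  have i1 := (integrable_poissonKernelGen (V := V) hα hy).comp_sub_right z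
  have i2 := (integrable_poissonKernelGen (V := V) hα one_pos).const_mul (y ^ (α + 1))
  calc _ ≤ ∫ x, 4 ^ ((α + finrank ℝ V + 1) / 2) * poissonWeight α z *
        (poissonKernelGen α y (x - z) + y ^ (α + 1) * poissonKernelGen α 1 x) :=
        integral_mono (integrable_poissonKernelGen_mul_poissonWeight hα hy z)
          ((i1.add i2).const_mul _) fun x => poissonKernelGen_mul_poissonWeight_le hα hy x z
    _ = 4 ^ ((α + finrank ℝ V + 1) / 2) * poissonWeight α z * (1 + y ^ (α + 1)) := by
        rw [integral_const_mul, integral_add i1 i2, integral_const_mul,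
          integral_sub_right_eq_self (poissonKernelGen α y), integral_poissonKernelGen hα hy,
          integral_poissonKernelGen hα one_pos, mul_one]
    _ ≤ 4 ^ ((α + finrank ℝ V + 1) / 2) * poissonWeight α z * (1 + 1) := by
        gcongr
        exact rpow_le_one hy.le hy1 (by linarith)
    _ = _ := by ring

/-- A function in the weighted `L¹` space is integrable against every translated kernel. -/
theorem integrable_poissonKernelGen_mul (hα : -1 < α) (hy : 0 < y) {h : V → ℝ}
    (hmeas : Measurable h) (hint : Integrable fun x => h x * poissonWeight α x) (x : V) :
    Integrable fun η => poissonKernelGen α y (x - η) * h η := by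
  have hd : (0 : ℝ) ≤ finrank ℝ V := by positivity
  have hs : 0 ≤ (α + finrank ℝ V + 1) / 2 := by linarith
  have h1 := Gamma_pos_of_pos (show 0 < (α + finrank ℝ V + 1) / 2 by linarith)
  have h2 := Gamma_pos_of_pos (show 0 < (α + 1) / 2 by linarith)
  set M := (1 + 2 * ‖x‖ ^ 2) / y ^ 2 + 2 with hM
  set c := Gamma ((α + finrank ℝ V + 1) / 2) /
    (Gamma ((α + 1) / 2) * π ^ ((finrank ℝ V : ℝ) / 2)) with hc
  have hM0 : 0 < M := by positivity
  refine (hint.norm.const_mul (c * y ^ (α + 1) * M ^ ((α + finrank ℝ V + 1) / 2))).mono'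
    (Measurable.aestronglyMeasurable
      ((measurable_poissonKernelGen.comp (by fun_prop)).mul hmeas))
    (Eventually.of_forall fun η => ?_)
  have hη : ‖η‖ ^ 2 ≤ 2 * ‖x‖ ^ 2 + 2 * ‖x - η‖ ^ 2 := by
    have := norm_sub_le x (x - η)
    rw [sub_sub_cancel] at this
    nlinarith [norm_nonneg η, sq_nonneg (‖x‖ - ‖x - η‖)]
  have hle : 1 + ‖η‖ ^ 2 ≤ M * (‖x - η‖ ^ 2 + y ^ 2) := by
    have e : M * (‖x - η‖ ^ 2 + y ^ 2) = (1 + 2 * ‖x‖ ^ 2) / y ^ 2 * ‖x - η‖ ^ 2 +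
        (1 + 2 * ‖x‖ ^ 2) + 2 * ‖x - η‖ ^ 2 + 2 * y ^ 2 := by
      rw [hM]; field_simp; ring
    have : 0 ≤ (1 + 2 * ‖x‖ ^ 2) / y ^ 2 * ‖x - η‖ ^ 2 := by positivity
    nlinarith [sq_nonneg y]
  have hle' : (‖x - η‖ ^ 2 + y ^ 2) ^ (-((α + finrank ℝ V + 1) / 2)) ≤
      M ^ ((α + finrank ℝ V + 1) / 2) * poissonWeight α η :=
    rpow_neg_le_mul_rpow_neg (by positivity) (by positivity) hM0 hs hle
  rw [norm_mul, norm_mul, norm_of_nonneg (poissonKernelGen_nonneg hα hy _),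
    norm_of_nonneg (poissonWeight_pos η).le]
  calc poissonKernelGen α y (x - η) * ‖h η‖
      = c * y ^ (α + 1) * (‖x - η‖ ^ 2 + y ^ 2) ^ (-((α + finrank ℝ V + 1) / 2)) * ‖h η‖ := by
        rw [poissonKernelGen, rpow_neg (by positivity), ← hc, div_eq_mul_inv]
    _ ≤ c * y ^ (α + 1) * (M ^ ((α + finrank ℝ V + 1) / 2) * poissonWeight α η) * ‖h η‖ := by
        gcongr
    _ = _ := by ring

/-- Convolution with the kernels of height at most one is bounded on the weighted `L¹` space. -/
theorem integral_abs_poissonKernelGen_conv_le (hα : -1 < α) (hy : 0 < y) (hy1 : y ≤ 1) {h : V → ℝ}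
    (hmeas : Measurable h) (hint : Integrable fun x => h x * poissonWeight α x) :
    Integrable (fun x => (∫ η, poissonKernelGen α y (x - η) * h η) * poissonWeight α x) ∧
    ∫ x, |∫ η, poissonKernelGen α y (x - η) * h η| * poissonWeight α x ≤
      2 * 4 ^ ((α + finrank ℝ V + 1) / 2) * ∫ x, |h x| * poissonWeight α x := by
  set C : ℝ := 2 * 4 ^ ((α + finrank ℝ V + 1) / 2)
  let F : V × V → ℝ := fun p => poissonKernelGen α y (p.1 - p.2) * h p.2 * poissonWeight α p.1
  have hFm : Measurable F :=
    ((measurable_poissonKernelGen.comp (by fun_prop)).mul (hmeas.comp measurable_snd)).mul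
      (measurable_poissonWeight.comp measurable_fst)
  have hnorm : ∀ x η, ‖F (x, η)‖ =
      |h η| * (poissonKernelGen α y (x - η) * poissonWeight α x) := fun x η => by
    simp only [F]
    rw [norm_mul, norm_mul, norm_of_nonneg (poissonKernelGen_nonneg hα hy _),
      norm_of_nonneg (poissonWeight_pos x).le, norm_eq_abs]
    ring
  have hle : ∀ η, ∫ x, ‖F (x, η)‖ ≤ C * (|h η| * poissonWeight α η) := fun η => by
    simp_rw [hnorm, integral_const_mul]
    calc _ ≤ |h η| * (C * poissonWeight α η) := by
          gcongr
          exact integral_poissonKernelGen_mul_poissonWeight_le hα hy hy1 η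
      _ = _ := by ring
  have habs : Integrable fun x => |h x| * poissonWeight α x := by
    refine hint.norm.congr (Eventually.of_forall fun x => ?_)
    simp [abs_of_pos (poissonWeight_pos x)]
  have hFi : Integrable F (volume.prod volume) := by
    rw [integrable_prod_iff' hFm.aestronglyMeasurable]
    refine ⟨Eventually.of_forall fun η => ?_, (habs.const_mul C).mono'
      hFm.norm.stronglyMeasurable.integral_prod_left'.aestronglyMeasurable (Eventually.of_forall fun η => ?_)⟩
    · refine ((integrable_poissonKernelGen_mul_poissonWeight hα hy η).const_mul (h η)).congr
        (Eventually.of_forall fun x => ?_)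
      simp only [F]
      ring
    · rw [norm_of_nonneg (integral_nonneg fun _ => norm_nonneg _)]
      exact hle η
  have hFconv : ∀ x, ∫ η, F (x, η) =
      (∫ η, poissonKernelGen α y (x - η) * h η) * poissonWeight α x :=
    fun x => integral_mul_const (poissonWeight α x) _
  have hci := hFi.integral_prod_left
  simp only [hFconv] at hci
  refine ⟨hci, ?_⟩
  calc _ ≤ ∫ x, ∫ η, ‖F (x, η)‖ := by
        refine integral_mono_of_nonneg (Eventually.of_forall fun x => ?_)
          hFi.integral_norm_prod_left (Eventually.of_forall fun x => ?_)
        · exact mul_nonneg (abs_nonneg _) (poissonWeight_pos x).le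
        · have := norm_integral_le_integral_norm (μ := volume) fun η => F (x, η)
          rwa [hFconv, norm_mul, norm_of_nonneg (poissonWeight_pos x).le] at this
    _ = ∫ η, ∫ x, ‖F (x, η)‖ := integral_integral_swap (f := fun x η => ‖F (x, η)‖) hFi.norm
    _ ≤ ∫ η, C * (|h η| * poissonWeight α η) :=
        integral_mono hFi.norm.integral_prod_right (habs.const_mul C) hle
    _ = _ := integral_const_mul _ _

theorem tendsto_poissonKernelGen_conv (hα : -1 < α) {g : V → ℝ} (hg : Integrable g)
    (hgc : Continuous g) (x : V) :
    Tendsto (fun y => ∫ η, poissonKernelGen α y (x - η) * g η) (𝓝[>] 0) (𝓝 (g x)) := by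
  have := (tendsto_integral_comp_smul_smul_of_integrable' (μ := (volume : Measure V))
    (poissonKernelGen_nonneg hα one_pos) (integral_poissonKernelGen_one (V := V) hα)
    (tendsto_norm_pow_mul_poissonKernelGen_one hα) hg (hgc.continuousAt (x := x))).comp
    tendsto_inv_nhdsGT_zero
  refine this.congr' ?_
  filter_upwards [self_mem_nhdsWithin] with y hy
  simp only [Function.comp_apply, smul_eq_mul, ← poissonKernelGen_eq_smul (V := V) hy]

theorem abs_poissonKernelGen_conv_le (hα : -1 < α) (hy : 0 < y) {g : V → ℝ} {B : ℝ}
    (hB : ∀ x, |g x| ≤ B) (x : V) : |∫ η, poissonKernelGen α y (x - η) * g η| ≤ B := by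
  calc _ ≤ ∫ η, poissonKernelGen α y (x - η) * B := by
        rw [← norm_eq_abs]
        refine norm_integral_le_of_norm_le
          (((integrable_poissonKernelGen hα hy).comp_sub_left x).mul_const B)
          (Eventually.of_forall fun η => ?_)
        rw [norm_mul, norm_of_nonneg (poissonKernelGen_nonneg hα hy _)]
        exact mul_le_mul_of_nonneg_left (hB η) (poissonKernelGen_nonneg hα hy _)
    _ = B := by
        rw [integral_mul_const, integral_sub_left_eq_self (poissonKernelGen α y),
          integral_poissonKernelGen hα hy, one_mul]

theorem tendsto_integral_abs_poissonKernelGen_conv_sub_of_continuous (hα : -1 < α) {g : V → ℝ}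
    (hgc : Continuous g) (hgs : HasCompactSupport g) :
    Tendsto (fun y => ∫ x, |(∫ η, poissonKernelGen α y (x - η) * g η) - g x| * poissonWeight α x)
      (𝓝[>] 0) (𝓝 0) := by
  obtain ⟨B, hB⟩ := hgs.exists_bound_of_continuous hgc
  have hg := hgc.integrable_of_hasCompactSupport hgs (μ := volume)
  have hmeas : ∀ y, Measurable fun x : V => ∫ η, poissonKernelGen α y (x - η) * g η := fun y =>
    (StronglyMeasurable.integral_prod_right (f := fun x η => poissonKernelGen α y (x - η) * g η)
      (Measurable.stronglyMeasurable ((measurable_poissonKernelGen.comp (by fun_prop)).mul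
        (hgc.measurable.comp measurable_snd)))).measurable
  rw [show 𝓝 (0 : ℝ) = 𝓝 (∫ _ : V, 0) by rw [integral_zero]]
  refine tendsto_integral_filter_of_dominated_convergence (fun x => (B + B) * poissonWeight α x)
    (Eventually.of_forall fun y => ?_) ?_ ((integrable_poissonWeight hα).const_mul _)
    (Eventually.of_forall fun x => ?_)
  · exact ((((hmeas y).sub hgc.measurable).norm).mul measurable_poissonWeight).aestronglyMeasurable
  · filter_upwards [self_mem_nhdsWithin] with y hy
    refine Eventually.of_forall fun x => ?_
    rw [norm_mul, norm_of_nonneg (poissonWeight_pos x).le, norm_of_nonneg (abs_nonneg _)]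
    refine mul_le_mul_of_nonneg_right ?_ (poissonWeight_pos x).le
    exact (abs_sub _ _).trans (add_le_add (abs_poissonKernelGen_conv_le hα hy hB x) (hB x))
  · have := (((tendsto_poissonKernelGen_conv hα hg hgc x).sub_const (g x)).abs).mul_const
      (poissonWeight α x)
    simpa using this

/-- Convolutions with the generalized Poisson kernels converge in the weighted `L¹` space. -/
theorem tendsto_integral_abs_poissonKernelGen_conv_sub (hα : -1 < α) {f : V → ℝ}
    (hmeas : Measurable f) (hf : Integrable fun x => f x * poissonWeight α x) :
    Tendsto (fun y => ∫ x, |(∫ η, poissonKernelGen α y (x - η) * f η) - f x| * poissonWeight α x)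
      (𝓝[>] 0) (𝓝 0) := by
  set C : ℝ := 2 * 4 ^ ((α + finrank ℝ V + 1) / 2)
  have hC0 : 0 < C := by positivity
  rw [Metric.tendsto_nhds]
  intro ε hε
  obtain ⟨G, hGs, hGε, hGc, hGi⟩ := hf.exists_hasCompactSupport_integral_sub_le
    (show 0 < ε / (2 * (C + 1)) by positivity)
  let g : V → ℝ := fun x => G x * (poissonWeight α x)⁻¹
  have hgw : ∀ x, g x * poissonWeight α x = G x := fun x =>
    inv_mul_cancel_right₀ (poissonWeight_pos x).ne' _
  have hgc : Continuous g :=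
    hGc.mul (continuous_poissonWeight.inv₀ fun x => (poissonWeight_pos x).ne')
  have hgs : HasCompactSupport g := hGs.mul_right
  have hgi : Integrable fun x => g x * poissonWeight α x := by simpa only [hgw] using hGi
  have hfg : Integrable fun x => (f x - g x) * poissonWeight α x := 
    (hf.sub hgi).congr (Eventually.of_forall fun x => (sub_mul _ _ _).symm)
  have habs : ∀ u : V → ℝ, Integrable (fun x => u x * poissonWeight α x) →
      Integrable fun x => |u x| * poissonWeight α x := fun u hu =>
    hu.norm.congr (Eventually.of_forall fun x => by simp [abs_of_pos (poissonWeight_pos x)])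
  have hfgε : ∫ x, |f x - g x| * poissonWeight α x ≤ ε / (2 * (C + 1)) := by
    refine le_of_eq_of_le (integral_congr_ae (Eventually.of_forall fun x => ?_)) hGε
    simp only
    rw [← hgw, ← sub_mul, norm_mul, norm_of_nonneg (poissonWeight_pos x).le, norm_eq_abs]
  have hlim := (tendsto_integral_abs_poissonKernelGen_conv_sub_of_continuous hα hgc
    hgs).eventually_lt_const (half_pos hε)
  filter_upwards [hlim, self_mem_nhdsWithin,
    mem_nhdsWithin_of_mem_nhds (Iic_mem_nhds (zero_lt_one (α := ℝ)))] with y hyε hy hy1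
  have hy : 0 < y := hy
  have hy1 : y ≤ 1 := hy1
  obtain ⟨i1, le1⟩ := integral_abs_poissonKernelGen_conv_le hα hy hy1
    (hmeas.sub hgc.measurable) hfg
  obtain ⟨i2, -⟩ := integral_abs_poissonKernelGen_conv_le hα hy hy1 hgc.measurable hgi
  have i3 : Integrable fun x =>
      ((∫ η, poissonKernelGen α y (x - η) * g η) - g x) * poissonWeight α x := 
    (i2.sub hgi).congr (Eventually.of_forall fun x => (sub_mul _ _ _).symm)
  have hsub : ∀ x, ∫ η, poissonKernelGen α y (x - η) * (f - g) η =
      (∫ η, poissonKernelGen α y (x - η) * f η) - ∫ η, poissonKernelGen α y (x - η) * g η :=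
    fun x => by
      rw [← integral_sub (integrable_poissonKernelGen_mul hα hy hmeas hf x)
        (integrable_poissonKernelGen_mul hα hy hgc.measurable hgi x)]
      simp only [Pi.sub_apply, mul_sub]
  rw [Real.dist_0_eq_abs, abs_of_nonneg
    (integral_nonneg fun x => mul_nonneg (abs_nonneg _) (poissonWeight_pos x).le)]
  have j1 := habs _ i1
  have j3 := habs _ i3
  have j4 := habs _ hfg
  calc _ ≤ ∫ x, (|∫ η, poissonKernelGen α y (x - η) * (f - g) η| * poissonWeight α x
          + |(∫ η, poissonKernelGen α y (x - η) * g η) - g x| * poissonWeight α x)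
          + |f x - g x| * poissonWeight α x := by
        refine integral_mono_of_nonneg
          (Eventually.of_forall fun x => mul_nonneg (abs_nonneg _) (poissonWeight_pos x).le)
          ((j1.add j3).add j4) (Eventually.of_forall fun x => ?_)
        simp only [← add_mul]
        refine mul_le_mul_of_nonneg_right ?_ (poissonWeight_pos x).le
        rw [hsub, abs_sub_comm (f x)]
        refine le_of_eq_of_le (congrArg _ ?_) (abs_add_three _ _ _)
        ring
    _ = (∫ x, |∫ η, poissonKernelGen α y (x - η) * (f - g) η| * poissonWeight α x)
          + (∫ x, |(∫ η, poissonKernelGen α y (x - η) * g η) - g x| * poissonWeight α x)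
          + ∫ x, |f x - g x| * poissonWeight α x := by
        rw [← integral_add j1 j3]
        exact integral_add (j1.add j3) j4
    _ ≤ C * (∫ x, |f x - g x| * poissonWeight α x)
          + (∫ x, |(∫ η, poissonKernelGen α y (x - η) * g η) - g x| * poissonWeight α x)
          + ∫ x, |f x - g x| * poissonWeight α x := by
        gcongr
        exact le1
    _ < C * (ε / (2 * (C + 1))) + ε / 2 + ε / (2 * (C + 1)) := by
        have := mul_le_mul_of_nonneg_left hfgε hC0.le
        linarith
    _ = ε := by field_simp; ring

end GeneralizedPoissonKernel

theorem stmt12 (n : ℕ) (hn : 1 ≤ n) (α : ℝ) (hα : -1 < α)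
    (K : EuclideanSpace ℝ (Fin n) → ℝ → ℝ)
    (hK : K = fun x y =>
      Real.Gamma ((α + n + 1) / 2) / (Real.Gamma ((α + 1) / 2) * Real.pi ^ ((n : ℝ) / 2))
        * y ^ (α + 1) / (‖x‖ ^ 2 + y ^ 2) ^ ((α + n + 1) / 2))
    (f : EuclideanSpace ℝ (Fin n) → ℝ)
    (hmeas : Measurable f)
    (hf : Integrable (fun x : EuclideanSpace ℝ (Fin n) =>
      |f x| * (1 + ‖x‖ ^ 2) ^ (-((α + n + 1) / 2)))) :
    Tendsto (fun y : ℝ =>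
        ∫ x : EuclideanSpace ℝ (Fin n),
          |(∫ η : EuclideanSpace ℝ (Fin n), K (x - η) y * f η) - f x|
            * (1 + ‖x‖ ^ 2) ^ (-((α + n + 1) / 2)))
      (𝓝[>] 0) (𝓝 0) := by
  have hw : ∀ x : EuclideanSpace ℝ (Fin n),
      (1 + ‖x‖ ^ 2) ^ (-((α + n + 1) / 2)) = poissonWeight α x := fun x => by
    rw [poissonWeight, finrank_euclideanSpace_fin]
  have hKp : ∀ x y, K x y = poissonKernelGen α y x := fun x y => by
    rw [hK, poissonKernelGen, finrank_euclideanSpace_fin]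
  simp only [hw, hKp] at hf ⊢
  refine tendsto_integral_abs_poissonKernelGen_conv_sub hα hmeas
    (hf.mono (hmeas.mul measurable_poissonWeight).aestronglyMeasurable
      (Eventually.of_forall fun x => ?_))
  simp
end
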